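/- Let K ⊆ H be a nonempty closed convex set, F : H → ℝ Fréchet differentiable with gradient ∇F, and let T* ∈ K be a minimizer of F over K. Assume F is star-convex on K around T*. Let T : [0,∞) → H be a solution of the constrained gradient flow of F in K starting at T₀ ∈ K, and assume t ↦ F(T(t)) is locally absolutely continuous. Assume additionally the power-type growth condition along the flow: there exist c > 0 and α > 0 such that ‖T(t) − T*‖² ≤ c·(F(T(t)) − F(T*))^α for almost every t ≥ 0. Then for almost every t > 0, ‖T(t) − T*‖² ≤ (c / (2^α · t^α)) · ‖T₀ − T*‖^{2α}. -/

import Mathlib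

open MeasureTheory
open scoped RealInnerProductSpace

variable {H : Type*} [NormedAddCommGroup H] [InnerProductSpace ℝ H] [CompleteSpace H]

/-- The tangent cone of a convex set `K` at a point `T ∈ K`. -/
def tanCone (K : Set H) (T : H) : Set H :=
  closure {w : H | ∃ t : ℝ, 0 < t ∧ T + t • w ∈ K}

/-- `w` is the metric projection of `v` onto the set `C`. -/
def IsProjOn (C : Set H) (v w : H) : Prop :=
  w ∈ C ∧ ∀ u ∈ C, ‖v - w‖ ≤ ‖v - u‖

/-- `T : [0,∞) → H` (with a.e. derivative `T'`) is a solution of the constrained gradient flow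
of `F` (with gradient `F'`) in `K` starting at `T₀`: a locally absolutely continuous curve
(encoded by the fundamental theorem of calculus with a locally integrable a.e.-derivative)
staying in `K`, starting at `T₀`, whose derivative at a.e. `t > 0` exists and is the projection
of `−F'(T(t))` onto the tangent cone of `K` at `T(t)`. -/
def IsFlowSol (K : Set H) (F' : H → H) (T₀ : H) (T T' : ℝ → H) : Prop :=
  T 0 = T₀ ∧
  (∀ t : ℝ, 0 ≤ t → T t ∈ K) ∧
  (∀ b : ℝ, 0 < b → IntervalIntegrable T' MeasureTheory.volume 0 b) ∧
  (∀ a b : ℝ, 0 ≤ a → a ≤ b → T b - T a = ∫ t in a..b, T' t) ∧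
  (∀ᵐ t ∂(MeasureTheory.volume.restrict (Set.Ioi (0 : ℝ))),
    HasDerivAt T (T' t) t ∧ IsProjOn (tanCone K (T t)) (-(F' (T t))) (T' t))

/-- `f : ℝ → ℝ` is locally absolutely continuous on `[0,∞)` with a.e. derivative `g`
(encoded by the fundamental theorem of calculus with a locally integrable a.e.-derivative). -/
def IsLocACWithDeriv (f g : ℝ → ℝ) : Prop :=
  (∀ b : ℝ, 0 < b → IntervalIntegrable g MeasureTheory.volume 0 b) ∧
  (∀ a b : ℝ, 0 ≤ a → a ≤ b → f b - f a = ∫ t in a..b, g t) ∧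
  (∀ᵐ t ∂(MeasureTheory.volume.restrict (Set.Ioi (0 : ℝ))), HasDerivAt f (g t) t)

/-- `F` is `λ`-star-convex on `K` around `Tstar`. -/
def StarConvexAround (lam : ℝ) (K : Set H) (F : H → ℝ) (Tstar : H) : Prop :=
  ∀ T ∈ K, ∀ s : ℝ, 0 ≤ s → s ≤ 1 →
    F ((1 - s) • T + s • Tstar) ≤
      (1 - s) * F T + s * F Tstar - lam / 2 * s * (1 - s) * ‖T - Tstar‖ ^ 2

/-- Absolute continuity is inherited by functions with smaller increments. -/
lemma ac_of_dist_le {X Y : Type*} [PseudoMetricSpace X] [PseudoMetricSpace Y]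
    {f : ℝ → X} {g : ℝ → Y} {a b : ℝ} (hg : AbsolutelyContinuousOnInterval g a b)
    (h : ∀ x ∈ Set.uIcc a b, ∀ y ∈ Set.uIcc a b, dist (f x) (f y) ≤ dist (g x) (g y)) :
    AbsolutelyContinuousOnInterval f a b := by
  rw [absolutelyContinuousOnInterval_iff] at hg ⊢
  intro ε hε
  obtain ⟨δ, hδ, H⟩ := hg ε hε
  refine ⟨δ, hδ, fun E hE hlt => lt_of_le_of_lt ?_ (H E hE hlt)⟩
  exact Finset.sum_le_sum fun i hi => h _ (hE.1 i hi).1 _ (hE.1 i hi).2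

lemma ac_of_integral {f g : ℝ → ℝ} {b : ℝ} (hb : 0 ≤ b)
    (hg : IntervalIntegrable g volume 0 b)
    (h : ∀ x y : ℝ, 0 ≤ x → x ≤ y → y ≤ b → |f y - f x| ≤ ∫ t in x..y, g t) :
    AbsolutelyContinuousOnInterval f 0 b := by
  have hG := hg.absolutelyContinuousOnInterval_intervalIntegral (c := 0) (by simp)
  refine ac_of_dist_le hG ?_
  have key : ∀ x y : ℝ, 0 ≤ x → x ≤ y → y ≤ b →
      dist (f x) (f y) ≤ dist (∫ t in (0:ℝ)..x, g t) (∫ t in (0:ℝ)..y, g t) := by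
    intro x y hx hxy hy
    have h1 : IntervalIntegrable g volume 0 x := hg.mono_set (by
      rw [Set.uIcc_of_le hx, Set.uIcc_of_le hb]; exact Set.Icc_subset_Icc_right (hxy.trans hy))
    have h2 : IntervalIntegrable g volume 0 y := hg.mono_set (by
      rw [Set.uIcc_of_le (hx.trans hxy), Set.uIcc_of_le hb]; exact Set.Icc_subset_Icc_right hy)
    rw [dist_comm, dist_comm (∫ t in (0:ℝ)..x, g t), Real.dist_eq, Real.dist_eq,
      intervalIntegral.integral_interval_sub_left h2 h1]
    exact (h x y hx hxy hy).trans (le_abs_self _)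
  intro x hx y hy
  rw [Set.uIcc_of_le hb] at hx hy
  rcases le_total x y with hxy | hxy
  · exact key x y hx.1 hxy hy.2
  · rw [dist_comm, dist_comm (∫ t in (0:ℝ)..x, g t)]
    exact key y x hy.1 hxy hx.2

lemma tanCone_convex {E : Type*} [NormedAddCommGroup E] [InnerProductSpace ℝ E] {K : Set E}
    (hK : Convex ℝ K) {x : E} (hx : x ∈ K) : Convex ℝ (tanCone K x) := by
  refine Convex.closure ?_
  rintro u ⟨t, ht, hu⟩ v ⟨s, hs, hv⟩ a b ha hb hab
  refine ⟨min t s, lt_min ht hs, ?_⟩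
  have shrink : ∀ (r p : ℝ) (w : E), 0 ≤ p → p ≤ r → 0 < r → x + r • w ∈ K → x + p • w ∈ K := by
    intro r p w hp hpr hr hw
    have := hK hx hw (a := 1 - p / r) (b := p / r)
      (sub_nonneg.2 ((div_le_one hr).2 hpr)) (by positivity) (by ring)
    convert this using 1
    rw [smul_add, smul_smul, div_mul_cancel₀ _ hr.ne', sub_smul, one_smul]
    abel
  have h1 := shrink t (min t s) u (lt_min ht hs).le (min_le_left _ _) ht hu
  have h2 := shrink s (min t s) v (lt_min ht hs).le (min_le_right _ _) hs hv
  have := hK h1 h2 ha hb hab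
  convert this using 1
  have hb' : b = 1 - a := by linarith
  subst hb'
  module

lemma tanCone_smul {E : Type*} [NormedAddCommGroup E] [InnerProductSpace ℝ E] {K : Set E}
    {x w : E} (hw : w ∈ tanCone K x) {r : ℝ} (hr : 0 < r) : r • w ∈ tanCone K x := by
  refine map_mem_closure (continuous_const_smul r) hw ?_
  rintro u ⟨t, ht, hu⟩
  refine ⟨t / r, by positivity, ?_⟩
  rwa [smul_smul, div_mul_cancel₀ _ hr.ne']

lemma proj_ineq {E : Type*} [NormedAddCommGroup E] [InnerProductSpace ℝ E] {K : Set E}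
    (hK : Convex ℝ K) {x v w : E} (hx : x ∈ K) (hw : IsProjOn (tanCone K x) v w) :
    ⟪v - w, w⟫ = 0 ∧ ∀ y ∈ K, ⟪v - w, y - x⟫ ≤ 0 := by
  have h0 : (0 : E) ∈ tanCone K x := subset_closure ⟨1, one_pos, by simpa using hx⟩
  have hvar : ∀ u ∈ tanCone K x, ⟪v - w, u - w⟫ ≤ 0 := by
    refine (norm_eq_iInf_iff_real_inner_le_zero (tanCone_convex hK hx) hw.1).1 ?_
    have : Nonempty (tanCone K x) := ⟨⟨0, h0⟩⟩
    refine le_antisymm (le_ciInf fun u => hw.2 u u.2) ?_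
    exact ciInf_le (f := fun u : tanCone K x => ‖v - u‖)
      ⟨0, by rintro _ ⟨u, rfl⟩; exact norm_nonneg _⟩ ⟨w, hw.1⟩
  have e1 := hvar 0 h0
  have e2 := hvar ((2:ℝ) • w) (tanCone_smul hw.1 two_pos)
  have e3 : ⟪v - w, w⟫ = 0 := by
    rw [zero_sub, inner_neg_right] at e1
    rw [two_smul, add_sub_cancel_right] at e2
    linarith
  refine ⟨e3, fun y hy => ?_⟩
  have := hvar (y - x) (subset_closure ⟨1, one_pos, by simpa using hy⟩)
  rw [inner_sub_right, e3] at this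
  linarith

lemma star_grad {E : Type*} [NormedAddCommGroup E] [InnerProductSpace ℝ E] [CompleteSpace E]
    {K : Set E} {F : E → ℝ} {p x y : E} (hF : HasGradientAt F p x) (hx : x ∈ K)
    (hs : StarConvexAround 0 K F y) : ⟪p, y - x⟫ ≤ F y - F x := by
  have hd : HasDerivAt (fun s : ℝ => F (x + s • (y - x))) ⟪p, y - x⟫ 0 := by
    have h1 : HasDerivAt (fun s : ℝ => x + s • (y - x)) (y - x) 0 := by
      simpa using ((hasDerivAt_id (0:ℝ)).smul_const (y - x)).const_add x
    have h2 : HasFDerivAt F (InnerProductSpace.toDual ℝ E p) (x + (0:ℝ) • (y - x)) := by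
      simpa using hF.hasFDerivAt
    have h3 := h2.comp_hasDerivAt (0:ℝ) h1
    rw [InnerProductSpace.toDual_apply_apply] at h3
    exact h3
  have ht := hd.tendsto_slope_zero_right
  refine le_of_tendsto ht ?_
  filter_upwards [Ioo_mem_nhdsGT (zero_lt_one (α := ℝ))] with s hs'
  have h := hs x hx s hs'.1.le hs'.2.le
  have e : (1 - s) • x + s • y = x + s • (y - x) := by module
  rw [e] at h
  simp only [zero_add, zero_smul, add_zero, smul_eq_mul]
  rw [inv_mul_le_iff₀ hs'.1]
  linarith

/-- Convergence of the flow itself under star-convexity and the power-type growth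
condition along the flow: `‖T(t) − T*‖² ≤ (c/(2^α t^α))·‖T₀ − T*‖^(2α)` for a.e. `t > 0`. -/
theorem flow_convergence_power_growth (K : Set H) (hKne : K.Nonempty)
    (hKcl : IsClosed K) (hKconv : Convex ℝ K)
    (F : H → ℝ) (F' : H → H) (hgrad : ∀ x : H, HasGradientAt F (F' x) x)
    (Tstar : H) (hTstar : Tstar ∈ K) (hmin : ∀ U ∈ K, F Tstar ≤ F U)
    (hstar : StarConvexAround 0 K F Tstar)
    (T₀ : H) (hT₀ : T₀ ∈ K) (T T' : ℝ → H)
    (hflow : IsFlowSol K F' T₀ T T')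
    (hAC : ∃ g : ℝ → ℝ, IsLocACWithDeriv (fun t => F (T t)) g)
    (c α : ℝ) (hc : 0 < c) (hα : 0 < α)
    (hgrowth : ∀ᵐ t ∂(MeasureTheory.volume.restrict (Set.Ici (0 : ℝ))),
      ‖T t - Tstar‖ ^ 2 ≤ c * (F (T t) - F Tstar) ^ α) :
    ∀ᵐ t ∂(MeasureTheory.volume.restrict (Set.Ioi (0 : ℝ))),
      ‖T t - Tstar‖ ^ 2 ≤ c / ((2 : ℝ) ^ α * t ^ α) * ‖T₀ - Tstar‖ ^ (2 * α) := by
  obtain ⟨hT0, hTK, hTi, hTint, hTae⟩ := hflow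
  obtain ⟨g, hgi, hgint, hgae⟩ := hAC
  have main : ∀ t : ℝ, 0 < t → t * (F (T t) - F Tstar) ≤ 1 / 2 * ‖T₀ - Tstar‖ ^ 2 := by
    intro b hb
    have hn : AbsolutelyContinuousOnInterval (fun t => ‖T t - Tstar‖) 0 b := by
      refine ac_of_integral hb.le (hTi b hb).norm ?_
      intro x y hx hxy hy
      calc |‖T y - Tstar‖ - ‖T x - Tstar‖| ≤ ‖T y - Tstar - (T x - Tstar)‖ :=
            abs_norm_sub_norm_le _ _
        _ = ‖∫ t in x..y, T' t‖ := by rw [sub_sub_sub_cancel_right, hTint x y hx hxy]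
        _ ≤ _ := intervalIntegral.norm_integral_le_integral_norm hxy
    have he : AbsolutelyContinuousOnInterval (fun t => F (T t) - F Tstar) 0 b := by
      refine ac_of_integral hb.le (hgi b hb).norm ?_
      intro x y hx hxy hy
      have h := hgint x y hx hxy
      simp only at h
      rw [sub_sub_sub_cancel_right, h, ← Real.norm_eq_abs]
      exact intervalIntegral.norm_integral_le_integral_norm (f := g) hxy
    have hid : AbsolutelyContinuousOnInterval (fun t : ℝ => t) 0 b :=
      ac_of_integral (g := fun _ => 1) hb.le (by simp) (by
        intro x y hx hxy hy
        simp [abs_of_nonneg (sub_nonneg.2 hxy)])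
    have hL := (hid.mul he).add ((hn.mul hn).const_mul (1 / 2))
    have hI := hL.integral_deriv_eq_sub
    have hle : ∫ x in (0:ℝ)..b, deriv (((fun t : ℝ => t) * fun t => F (T t) - F Tstar) +
        fun x => 1 / 2 * ((fun t => ‖T t - Tstar‖) * fun t => ‖T t - Tstar‖) x) x ≤ 0 := by
      rw [intervalIntegral.integral_of_le hb.le]
      refine integral_nonpos_of_ae ?_
      have hsub : Set.Ioc (0:ℝ) b ⊆ Set.Ioi 0 := fun x hx => hx.1
      filter_upwards [ae_restrict_of_ae_restrict_of_subset hsub hTae,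
        ae_restrict_mem measurableSet_Ioc] with t ht htm
      obtain ⟨hd, hp⟩ := ht
      have hK := hTK t htm.1.le
      obtain ⟨p1, p2⟩ := proj_ineq hKconv hK hp
      have p3 := p2 Tstar hTstar
      have p4 := star_grad (hgrad (T t)) hK hstar
      have d1 : HasDerivAt (fun t => F (T t) - F Tstar) ⟪F' (T t), T' t⟫ t := by
        have := (hgrad (T t)).hasFDerivAt.comp_hasDerivAt t hd
        simpa using this.sub_const (F Tstar)
      have d2 : HasDerivAt (fun t => ‖T t - Tstar‖ * ‖T t - Tstar‖)
          (2 * ⟪T t - Tstar, T' t⟫) t := by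
        have := (hd.sub_const Tstar).norm_sq
        simpa [pow_two] using this
      have d3 := ((hasDerivAt_id t).mul d1).add (d2.const_mul (1 / 2))
      have d4 : deriv (((fun t : ℝ => t) * fun t => F (T t) - F Tstar) +
        fun x => 1 / 2 * ((fun t => ‖T t - Tstar‖) * fun t => ‖T t - Tstar‖) x) t = _ := d3.deriv
      rw [d4]
      have q1 : ⟪F' (T t), T' t⟫ = - ‖T' t‖ ^ 2 := by
        rw [inner_sub_left, inner_neg_left, real_inner_self_eq_norm_sq] at p1
        linarith
      have q2 : ⟪T t - Tstar, T' t⟫ ≤ ⟪F' (T t), Tstar - T t⟫ := by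
        rw [inner_sub_left, inner_neg_left] at p3
        have : ⟪T t - Tstar, T' t⟫ = - ⟪T' t, Tstar - T t⟫ := by
          rw [real_inner_comm, ← inner_neg_right, neg_sub]
        linarith
      have q3 : 0 ≤ t * ‖T' t‖ ^ 2 := mul_nonneg htm.1.le (sq_nonneg _)
      simp only [id, Pi.zero_apply]
      rw [q1]
      linarith
    rw [hI] at hle
    simp only [Pi.add_apply, Pi.mul_apply, hT0] at hle
    nlinarith [sq_nonneg ‖T b - Tstar‖]
  have hsub : Set.Ioi (0:ℝ) ⊆ Set.Ici 0 := Set.Ioi_subset_Ici_self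
  filter_upwards [ae_restrict_of_ae_restrict_of_subset hsub hgrowth,
    ae_restrict_mem measurableSet_Ioi] with t ht htm
  have htp : 0 < t := htm
  have he0 : 0 ≤ F (T t) - F Tstar := sub_nonneg.2 (hmin _ (hTK t htp.le))
  have he : F (T t) - F Tstar ≤ ‖T₀ - Tstar‖ ^ 2 / (2 * t) := by
    rw [le_div_iff₀ (by positivity)]
    linarith [main t htp]
  calc ‖T t - Tstar‖ ^ 2 ≤ c * (F (T t) - F Tstar) ^ α := ht
    _ ≤ c * (‖T₀ - Tstar‖ ^ 2 / (2 * t)) ^ α := by gcongr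
    _ = _ := by
      rw [Real.div_rpow (by positivity) (by positivity), Real.mul_rpow (by norm_num) htp.le,
        Real.rpow_mul (norm_nonneg _)]
      norm_num
      ring
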